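/- arXiv:2410.05529 — 3 statements merged into one kernel-verified Lean document; each statement's English description precedes it below -/
import Mathlib

section
/- Let λ denote Lebesgue measure on [0,1] and let X : [0,1] → [0,1] be Borel measurable. Then the following are equivalent: (1) for μ_X-a.e. x, the measure ν(x) is atomless; (2) there exists a mod-null isomorphism Φ from ([0,1], λ) to ([0,1] × [0,1], μ_X × λ) such that π₁ ∘ Φ = X λ-a.e.; (3) there exists a mod-null isomorphism Ψ from ([0,1], λ) to ([0,1] × [0,1], λ × λ) such that X ∘ π₁ ∘ Ψ = X λ-a.e.; (4) there exist a mod-null isomorphism Ψ from ([0,1], λ) to ([0,1] × [0,1], λ × λ) and a Borel measurable map Z : [0,1] → [0,1] such that Z ∘ π₁ ∘ Ψ = X λ-a.e.; (5) there exists a sequence of Borel measurable functions Z_n : [0,1] → ℝ taking values in {−1, 1} such that for every Borel measurable W : [0,1] → [0,1], ‖E[Z_n · W | σ(X)]‖_{L²(λ)} → 0 as n → ∞. -/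
open MeasureTheory ProbabilityTheory Filter
open scoped ENNReal Topology

local notation "I01" => Set.Icc (0:ℝ) 1

section ModNullInverse

variable {α β γ δ : Type*} [MeasurableSpace α] [MeasurableSpace β] [MeasurableSpace γ]
  [MeasurableSpace δ] {μ : Measure α} {ν : Measure β} {ρ : Measure γ} {τ : Measure δ}

/-- `f` and `g` are measure-preserving maps that are inverse to each other off null sets. -/
structure ModNullInverse (μ : Measure α) (ν : Measure β) (f : α → β) (g : β → α) : Prop where
  map_fwd : MeasurePreserving f μ ν
  map_bwd : MeasurePreserving g ν μ
  left_inv : ∀ᵐ a ∂μ, g (f a) = a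
  right_inv : ∀ᵐ b ∂ν, f (g b) = b

namespace ModNullInverse

/-- A measurable map with an almost everywhere right inverse that preserves measure is itself
measure-preserving, and the two maps are inverse to each other off null sets. -/
lemma of_right_inv [MeasurableEq α] {f : α → β} {g : β → α} (hf : Measurable f)
    (hg : MeasurePreserving g ν μ) (h : ∀ᵐ b ∂ν, f (g b) = b) : ModNullInverse μ ν f g where
  map_fwd := by
    refine ⟨hf, ?_⟩
    rw [← hg.map_eq, Measure.map_map hf hg.measurable, Measure.map_congr (show f ∘ g =ᵐ[ν] id from h),
      Measure.map_id]
  map_bwd := hg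
  left_inv := by
    rw [← hg.map_eq]
    refine (ae_map_iff hg.measurable.aemeasurable
      (measurableSet_eq_fun (hg.measurable.comp hf) measurable_id)).2 ?_
    filter_upwards [h] with b hb
    simp [hb]
  right_inv := h

lemma of_measurableEquiv (e : α ≃ᵐ β) (he : MeasurePreserving e μ ν) :
    ModNullInverse μ ν e e.symm :=
  ⟨he, he.symm e, ae_of_all _ e.symm_apply_apply, ae_of_all _ e.apply_symm_apply⟩

lemma symm {f : α → β} {g : β → α} (h : ModNullInverse μ ν f g) : ModNullInverse ν μ g f :=
  ⟨h.map_bwd, h.map_fwd, h.right_inv, h.left_inv⟩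

lemma trans {f : α → β} {g : β → α} {f' : β → γ} {g' : γ → β} (h : ModNullInverse μ ν f g)
    (h' : ModNullInverse ν ρ f' g') : ModNullInverse μ ρ (f' ∘ f) (g ∘ g') where
  map_fwd := h'.map_fwd.comp h.map_fwd
  map_bwd := h.map_bwd.comp h'.map_bwd
  left_inv := by
    filter_upwards [h.left_inv, h.map_fwd.quasiMeasurePreserving.ae h'.left_inv] with a ha ha'
    simp [ha, ha']
  right_inv := by
    filter_upwards [h'.right_inv, h'.map_bwd.quasiMeasurePreserving.ae h.right_inv] with a ha ha'
    simp [ha, ha']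

lemma prodMap [SFinite μ] [SFinite ν] [SFinite ρ] [SFinite τ] {f : α → β} {g : β → α}
    {f' : γ → δ} {g' : δ → γ} (h : ModNullInverse μ ν f g) (h' : ModNullInverse ρ τ f' g') :
    ModNullInverse (μ.prod ρ) (ν.prod τ) (Prod.map f f') (Prod.map g g') where
  map_fwd := h.map_fwd.prod h'.map_fwd
  map_bwd := h.map_bwd.prod h'.map_bwd
  left_inv := by
    filter_upwards [Measure.quasiMeasurePreserving_fst.ae h.left_inv,
      Measure.quasiMeasurePreserving_snd.ae h'.left_inv] with p hp hp'
    exact Prod.ext hp hp'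
  right_inv := by
    filter_upwards [Measure.quasiMeasurePreserving_fst.ae h.right_inv,
      Measure.quasiMeasurePreserving_snd.ae h'.right_inv] with p hp hp'
    exact Prod.ext hp hp'

lemma refl (μ : Measure α) : ModNullInverse μ μ id id :=
  ⟨.id μ, .id μ, by simp, by simp⟩

end ModNullInverse

end ModNullInverse

section Quantile

/-- The cumulative distribution function of a probability measure on `[0,1]`, as a map of `[0,1]`
to itself. -/
noncomputable def unitCdf (ρ : Measure ↥I01) [IsProbabilityMeasure ρ] (y : ↥I01) : ↥I01 :=
  ⟨ρ.real (Set.Iic y), measureReal_nonneg, measureReal_le_one⟩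

/-- The quantile function of a probability measure on `[0,1]`. -/
noncomputable def unitQuantile (ρ : Measure ↥I01) [IsProbabilityMeasure ρ] (u : ↥I01) : ↥I01 :=
  sInf {y | u ≤ unitCdf ρ y}

variable (ρ : Measure ↥I01) [IsProbabilityMeasure ρ]

lemma unitCdf_mono : Monotone (unitCdf ρ) := fun _ _ h =>
  measureReal_mono (Set.Iic_subset_Iic.2 h)

lemma ofReal_unitCdf (y : ↥I01) : ENNReal.ofReal (unitCdf ρ y : ℝ) = ρ (Set.Iic y) :=
  ofReal_measureReal

lemma le_unitCdf_iff (u y : ↥I01) :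
    u ≤ unitCdf ρ y ↔ ENNReal.ofReal (u : ℝ) ≤ ρ (Set.Iic y) := by
  rw [← ofReal_unitCdf, ENNReal.ofReal_le_ofReal_iff (unitCdf ρ y).2.1, Subtype.coe_le_coe]

lemma le_unitCdf_unitQuantile (u : ↥I01) : u ≤ unitCdf ρ (unitQuantile ρ u) := by
  have hne : {y | u ≤ unitCdf ρ y}.Nonempty := by
    refine ⟨⊤, ?_⟩
    rw [Set.mem_ofPred_eq, le_unitCdf_iff, Set.Iic_top, measure_univ]
    exact ENNReal.ofReal_le_one.2 u.2.2
  obtain ⟨z, hz, hle, hlim, hmem⟩ := (isGLB_sInf {y | u ≤ unitCdf ρ y}).exists_seq_antitone_tendsto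
    hne
  rw [le_unitCdf_iff]
  have hInter : ⋂ n, Set.Iic (z n) = Set.Iic (unitQuantile ρ u) := by
    ext y
    simp only [Set.mem_iInter, Set.mem_Iic]
    exact ⟨fun h => ge_of_tendsto' hlim h, fun h n => h.trans (hle n)⟩
  rw [← hInter]
  exact ge_of_tendsto' (tendsto_measure_iInter_atTop
    (fun n => measurableSet_Iic.nullMeasurableSet)
    (fun _ _ h => Set.Iic_subset_Iic.2 (hz h)) ⟨0, measure_ne_top _ _⟩)
    fun n => (le_unitCdf_iff ρ u (z n)).1 (hmem n)

lemma unitQuantile_le_iff (u y : ↥I01) : unitQuantile ρ u ≤ y ↔ u ≤ unitCdf ρ y :=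
  ⟨fun h => (le_unitCdf_unitQuantile ρ u).trans (unitCdf_mono ρ h), fun h => sInf_le h⟩

lemma unitCdf_unitQuantile (hρ : ∀ y, ρ {y} = 0) (u : ↥I01) :
    unitCdf ρ (unitQuantile ρ u) = u := by
  refine le_antisymm ?_ (le_unitCdf_unitQuantile ρ u)
  rw [← Subtype.coe_le_coe, ← ENNReal.ofReal_le_ofReal_iff u.2.1, ofReal_unitCdf]
  have hIio : ρ (Set.Iic (unitQuantile ρ u)) = ρ (Set.Iio (unitQuantile ρ u)) := by
    refine le_antisymm ?_ (measure_mono Set.Iio_subset_Iic_self)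
    rw [← Set.Iio_union_right]
    exact (measure_union_le _ _).trans (by rw [hρ, add_zero])
  rw [hIio]
  rcases eq_bot_or_bot_lt (unitQuantile ρ u) with h | h
  · simp [h]
  · obtain ⟨z, hz, hmem, hlim⟩ := exists_seq_strictMono_tendsto' h
    have hsub : Set.Iio (unitQuantile ρ u) ⊆ ⋃ n, Set.Iic (z n) := fun y hy =>
      have ⟨n, hn⟩ := (hlim.eventually_const_lt hy).exists
      Set.mem_iUnion.2 ⟨n, hn.le⟩
    refine (measure_mono hsub).trans (le_of_tendsto' (tendsto_measure_iUnion_atTop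
      fun _ _ h => Set.Iic_subset_Iic.2 (hz.monotone h)) fun n => ?_)
    have hlt := mt (unitQuantile_le_iff ρ u (z n)).2 (hmem n).2.not_ge
    rw [le_unitCdf_iff, not_le] at hlt
    exact hlt.le

lemma measurable_unitCdf {α : Type*} [MeasurableSpace α] (κ : Kernel α ↥I01) [IsMarkovKernel κ] :
    Measurable fun p : α × ↥I01 => unitCdf (κ p.1) p.2 := by
  refine Measurable.subtype_mk (Measurable.ennreal_toReal ?_)
  exact Kernel.measurable_kernel_prodMk_left (κ := κ.prodMkRight ↥I01)
    (t := {q : (α × ↥I01) × ↥I01 | q.2 ≤ q.1.2})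
    (measurableSet_le measurable_snd measurable_fst.snd)

lemma measurable_unitQuantile {α : Type*} [MeasurableSpace α] (κ : Kernel α ↥I01)
    [IsMarkovKernel κ] : Measurable fun p : α × ↥I01 => unitQuantile (κ p.1) p.2 := by
  refine measurable_of_Iic fun y => ?_
  simp only [Set.preimage, Set.mem_Iic, unitQuantile_le_iff]
  exact measurableSet_le measurable_snd ((measurable_unitCdf κ).comp (by fun_prop :
    Measurable fun p : α × ↥I01 => (p.1, y)))

lemma measurable_unitQuantile_apply : Measurable (unitQuantile ρ) :=
  (measurable_unitQuantile (Kernel.const Unit ρ)).comp (measurable_prodMk_left (x := ()))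

lemma measurable_unitCdf_apply : Measurable (unitCdf ρ) :=
  (unitCdf_mono ρ).measurable

lemma map_unitQuantile : Measure.map (unitQuantile ρ) volume = ρ := by
  have hm := measurable_unitQuantile_apply ρ
  refine Measure.ext_of_Iic _ _ fun y => ?_
  have hpre : unitQuantile ρ ⁻¹' Set.Iic y = Set.Iic (unitCdf ρ y) := by
    ext u
    exact unitQuantile_le_iff ρ u y
  rw [Measure.map_apply hm measurableSet_Iic, hpre, ← ofReal_unitCdf ρ]
  exact unitInterval.volume_Iic _

lemma map_prodMk_unitQuantile {α : Type*} [MeasurableSpace α] (μ : Measure α) [SFinite μ]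
    (κ : Kernel α ↥I01) [IsMarkovKernel κ] :
    Measure.map (fun p : α × ↥I01 => (p.1, unitQuantile (κ p.1) p.2)) (μ.prod volume) =
      μ ⊗ₘ κ := by
  have hm : Measurable fun p : α × ↥I01 => (p.1, unitQuantile (κ p.1) p.2) :=
    measurable_fst.prodMk (measurable_unitQuantile κ)
  ext s hs
  rw [Measure.map_apply hm hs, Measure.prod_apply (hm hs), Measure.compProd_apply hs]
  refine lintegral_congr fun x => ?_
  conv_rhs => rw [← map_unitQuantile (κ x), Measure.map_apply (measurable_unitQuantile_apply _)
    (measurable_prodMk_left hs)]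
  rfl

/-- An atomless Borel probability measure on a standard Borel space is isomorphic mod null sets to
Lebesgue measure on `[0,1]`. -/
lemma exists_modNullInverse_volume {β : Type*} [MeasurableSpace β] [StandardBorelSpace β]
    (τ : Measure β) [IsProbabilityMeasure τ] [NullSingletonClass τ] :
    ∃ (f : ↥I01 → β) (g : β → ↥I01), ModNullInverse volume τ f g := by
  have hβ : ¬ Countable β := fun _ =>
    one_ne_zero (measure_univ.symm.trans (Set.countable_univ.measure_zero τ))
  have hI : ¬ Countable ↥I01 := fun _ =>
    one_ne_zero (measure_univ.symm.trans
      (Set.countable_univ.measure_zero (volume : Measure ↥I01)))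
  let e := PolishSpace.measurableEquivOfNotCountable hβ hI
  have he : MeasurePreserving e τ (τ.map e) := e.measurable.measurePreserving τ
  have : IsProbabilityMeasure (τ.map e) := Measure.isProbabilityMeasure_map e.measurable.aemeasurable
  have hatom : ∀ y, τ.map e {y} = 0 := fun y => by
    rw [e.map_apply, ← e.image_symm, Set.image_singleton, measure_singleton]
  have hq : ModNullInverse (τ.map e) volume (unitCdf (τ.map e)) (unitQuantile (τ.map e)) :=
    .of_right_inv (measurable_unitCdf_apply _)
      ⟨measurable_unitQuantile_apply _, map_unitQuantile _⟩
      (ae_of_all _ (unitCdf_unitQuantile _ hatom))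
  exact ⟨_, _, ((ModNullInverse.of_measurableEquiv e he).trans hq).symm⟩

end Quantile

section Fibers

variable {X : ↥I01 → ↥I01}

/-- If the disintegration of Lebesgue measure along `X` is almost surely atomless, then Lebesgue
measure is isomorphic over `X` to the product of the law of `X` with Lebesgue measure. -/
lemma exists_modNullInverse_prod (hX : Measurable X) (κ : Kernel ↥I01 ↥I01) [IsMarkovKernel κ]
    (hκ : Measure.map X volume ⊗ₘ κ = Measure.map (fun t => (X t, t)) volume)
    (hatom : ∀ᵐ x ∂(Measure.map X volume), ∀ y, κ x {y} = 0) :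
    ∃ (Φ : ↥I01 → ↥I01 × ↥I01) (Φ' : ↥I01 × ↥I01 → ↥I01),
      ModNullInverse volume ((Measure.map X volume).prod volume) Φ Φ' ∧
        ∀ᵐ t ∂(volume : Measure ↥I01), (Φ t).1 = X t := by
  have hpair : Measurable fun t => (X t, t) := hX.prodMk measurable_id
  have hmap := (map_prodMk_unitQuantile (Measure.map X volume) κ).trans hκ
  have hQ := measurable_unitQuantile κ
  refine ⟨fun t => (X t, unitCdf (κ (X t)) t), fun p => unitQuantile (κ p.1) p.2,
    .of_right_inv (hX.prodMk ((measurable_unitCdf κ).comp hpair)) ⟨hQ, ?_⟩ ?_,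
    ae_of_all _ fun _ => rfl⟩
  · have h := congrArg (Measure.map Prod.snd) hmap
    rw [Measure.map_map measurable_snd (measurable_fst.prodMk hQ),
      Measure.map_map measurable_snd hpair] at h
    exact h.trans Measure.map_id
  · have hgraph : ∀ᵐ p ∂((Measure.map X volume).prod volume),
        X (unitQuantile (κ p.1) p.2) = p.1 := by
      have hs : MeasurableSet {q : ↥I01 × ↥I01 | X q.2 = q.1} :=
        measurableSet_eq_fun (hX.comp measurable_snd) measurable_fst
      have h : ∀ᵐ q ∂(Measure.map (fun t => (X t, t)) volume), X q.2 = q.1 :=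
        (ae_map_iff hpair.aemeasurable hs).2 (ae_of_all _ fun _ => rfl)
      rw [← hmap] at h
      exact ae_of_ae_map (measurable_fst.prodMk hQ).aemeasurable h
    filter_upwards [hgraph, Measure.quasiMeasurePreserving_fst.ae hatom] with p hp hp'
    rw [hp]
    exact Prod.ext rfl (unitCdf_unitQuantile _ hp' _)

lemma exists_modNullInverse_volume_prod {Φ : ↥I01 → ↥I01 × ↥I01} {Φ' : ↥I01 × ↥I01 → ↥I01}
    {μ : Measure ↥I01} [SFinite μ] (hΦ : ModNullInverse volume (μ.prod volume) Φ Φ')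
    (hfst : ∀ᵐ t ∂(volume : Measure ↥I01), (Φ t).1 = X t) :
    ∃ (Ψ : ↥I01 → ↥I01 × ↥I01) (Ψ' : ↥I01 × ↥I01 → ↥I01),
      ModNullInverse volume ((volume : Measure ↥I01).prod volume) Ψ Ψ' ∧
        ∀ᵐ t ∂(volume : Measure ↥I01), X (Ψ t).1 = X t := by
  obtain ⟨θ, θ', hθ⟩ :=
    exists_modNullInverse_volume ((volume : Measure ↥I01).prod (volume : Measure ↥I01))
  have hsplit := hΦ.trans ((ModNullInverse.refl μ).prodMap hθ)
  have hassoc := ModNullInverse.of_measurableEquiv MeasurableEquiv.prodAssoc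
    (measurePreserving_prodAssoc μ (volume : Measure ↥I01) (volume : Measure ↥I01))
  refine ⟨_, _, (hsplit.trans hassoc.symm).trans (hΦ.symm.prodMap (.refl volume)), ?_⟩
  have hX' : ∀ᵐ q ∂(μ.prod volume), X (Φ' q) = q.1 := by
    filter_upwards [hΦ.right_inv, hΦ.map_bwd.quasiMeasurePreserving.ae hfst] with q hq hq'
    rw [← hq', hq]
  have hq := Measure.quasiMeasurePreserving_fst.comp
    (hsplit.trans hassoc.symm).map_fwd.quasiMeasurePreserving
  filter_upwards [hq.ae hX', hfst] with t ht ht'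
  exact ht.trans ht'

end Fibers

section WeaklyNullSigns

lemma exists_orthogonal_signs : ∃ r : ℕ → ↥I01 → ℝ, (∀ n, Measurable (r n)) ∧
    (∀ n t, r n t = 1 ∨ r n t = -1) ∧
    Pairwise fun m n => ∫ t, r m t * r n t = 0 := by
  let s : Bool → ℝ := fun b => bif b then 1 else -1
  have hs : Measurable s := measurable_of_finite s
  let P : Measure Bool := (2⁻¹ : ℝ≥0∞) • (Measure.dirac true + Measure.dirac false)
  have : IsProbabilityMeasure P := ⟨by
    simp [P, ENNReal.inv_two_add_inv_two]⟩
  have hP : ∫ b, s b ∂P = 0 := by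
    rw [integral_smul_measure, integral_add_measure .of_finite .of_finite]
    simp [s]
  obtain ⟨T, hT, hTmap⟩ := Measure.exists_measurable_map_eq (Measure.infinitePi fun _ : ℕ => P)
  have hTn : ∀ n, Measurable fun t => T t n := fun n => (measurable_pi_apply n).comp hT
  refine ⟨fun n t => s (T t n), fun n => hs.comp (hTn n), fun n t => ?_, fun m n hmn => ?_⟩
  · cases h : T t n <;> simp [s, h]
  · have hmeas : ∀ n, Measurable fun ω : ℕ → Bool => s (ω n) := fun n =>
      hs.comp (measurable_pi_apply n)
    have hind := (iIndepFun_infinitePi (P := fun _ : ℕ => P) (X := fun _ => s)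
      fun _ => hs).indepFun hmn
    calc ∫ t, s (T t m) * s (T t n)
        = ∫ ω, s (ω m) * s (ω n) ∂(Measure.infinitePi fun _ : ℕ => P) := by
          rw [← hTmap]
          exact (integral_map hT.aemeasurable
            ((hmeas m).mul (hmeas n)).aestronglyMeasurable).symm
      _ = (∫ ω, s (ω m) ∂(Measure.infinitePi fun _ : ℕ => P)) *
            ∫ ω, s (ω n) ∂(Measure.infinitePi fun _ : ℕ => P) :=
          hind.integral_fun_mul_eq_mul_integral (hmeas m).aestronglyMeasurable
            (hmeas n).aestronglyMeasurable
      _ = 0 := by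
          have hm := measurePreserving_eval_infinitePi (fun _ : ℕ => P) m
          have h := integral_map (μ := Measure.infinitePi fun _ : ℕ => P)
            hm.measurable.aemeasurable (f := s) hs.aestronglyMeasurable
          rw [hm.map_eq, hP] at h
          rw [← h, zero_mul]

/-- There are `±1`-valued functions on `[0,1]` that converge weakly to zero in `L²`. -/
lemma exists_weakly_null_signs : ∃ r : ℕ → ↥I01 → ℝ, (∀ n, Measurable (r n)) ∧
    (∀ n t, r n t = 1 ∨ r n t = -1) ∧
    ∀ f : ↥I01 → ℝ, MemLp f 2 volume → Tendsto (fun n => ∫ t, r n t * f t) atTop (𝓝 0) := by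
  obtain ⟨r, hr, hsign, horth⟩ := exists_orthogonal_signs
  have hr2 : ∀ n, MemLp (r n) 2 (volume : Measure ↥I01) := fun n =>
    MemLp.of_bound (hr n).aestronglyMeasurable 1 (ae_of_all _ fun t => by
      rcases hsign n t with h | h <;> simp [h])
  refine ⟨r, hr, hsign, fun f hf => ?_⟩
  have hinner : ∀ n (g : ↥I01 → ℝ) (hg : MemLp g 2 volume),
      inner ℝ ((hr2 n).toLp (r n)) (hg.toLp g) = ∫ t, r n t * g t := fun n g hg => by
    rw [L2.inner_def]
    refine integral_congr_ae ?_
    filter_upwards [(hr2 n).coeFn_toLp, hg.coeFn_toLp] with t h h'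
    rw [h, h', Real.inner_apply]
  have hv : Orthonormal ℝ fun n => (hr2 n).toLp (r n) := by
    refine ⟨fun n => ?_, fun m n hmn => (hinner m _ (hr2 n)).trans (horth hmn)⟩
    have h := real_inner_self_eq_norm_sq ((hr2 n).toLp (r n))
    have hsq : ∀ t, r n t * r n t = 1 := fun t => by rcases hsign n t with h | h <;> simp [h]
    simp only [hinner, hsq, integral_const, probReal_univ, smul_eq_mul, mul_one] at h
    exact (pow_eq_one_iff_of_nonneg (norm_nonneg _) two_ne_zero).1 h.symm
  have h := (hv.inner_products_summable (hf.toLp f)).tendsto_atTop_zero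
  simp only [hinner, Real.norm_eq_abs, sq_abs] at h
  rw [tendsto_zero_iff_abs_tendsto_zero]
  simpa [Function.comp_def, Real.sqrt_sq_eq_abs] using (Real.continuous_sqrt.tendsto 0).comp h

end WeaklyNullSigns

section CondExp

variable {X : ↥I01 → ↥I01}

lemma exists_condExp_eq_comp (hX : Measurable X) {f : ↥I01 → ℝ} (hf : Measurable f)
    (hf1 : ∀ t, |f t| ≤ 1) : ∃ φ : ↥I01 → ℝ, Measurable φ ∧ (∀ x, |φ x| ≤ 1) ∧
      eLpNorm ((volume : Measure ↥I01)[f | MeasurableSpace.comap X inferInstance]) 2 volume =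
        ENNReal.ofReal (√(∫ t, φ (X t) * f t)) := by
  let φ : ↥I01 → ℝ := fun x => ∫ y, f y ∂(condDistrib id X volume x)
  have hφ : Measurable φ :=
    (StronglyMeasurable.integral_condDistrib (f := fun p : ↥I01 × ↥I01 => f p.2)
      (hf.comp measurable_snd).stronglyMeasurable).measurable
  have hφ1 : ∀ x, |φ x| ≤ 1 := fun x => by
    simpa using norm_integral_le_of_norm_le_const (f := f) (C := 1)
      (ae_of_all (condDistrib id X volume x) hf1)
  have hint : Integrable f (volume : Measure ↥I01) :=
    .of_bound hf.aestronglyMeasurable 1 (ae_of_all _ hf1)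
  have hE := condExp_ae_eq_integral_condDistrib_id (μ := (volume : Measure ↥I01)) hX hint
  have hφX : MemLp (fun t => φ (X t)) 2 (volume : Measure ↥I01) :=
    .of_bound (hφ.comp hX).aestronglyMeasurable 1 (ae_of_all _ fun t => hφ1 _)
  have hmul : Integrable (fun t => φ (X t) * f t) (volume : Measure ↥I01) :=
    hint.bdd_mul (hφ.comp hX).aestronglyMeasurable (c := 1) (ae_of_all _ fun t => hφ1 _)
  have hself : ∫ t, φ (X t) * f t = ∫ t, φ (X t) * φ (X t) := by
    rw [← integral_condExp hX.comap_le]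
    refine integral_congr_ae ?_
    filter_upwards [condExp_mul_of_stronglyMeasurable_left
      (hφ.comp (comap_measurable X)).stronglyMeasurable hmul hint, hE] with t h h'
    exact h.trans (congrArg (φ (X t) * ·) h')
  refine ⟨φ, hφ, hφ1, ?_⟩
  rw [eLpNorm_congr_ae hE, hself]
  refine (hφX.eLpNorm_eq_integral_rpow_norm two_ne_zero ENNReal.ofNat_ne_top).trans ?_
  simp [Real.sqrt_eq_rpow, ← sq]

lemma tendsto_condExp_of_modNullInverse (hX : Measurable X) {Ψ : ↥I01 → ↥I01 × ↥I01}
    {Ψ' : ↥I01 × ↥I01 → ↥I01} {Z : ↥I01 → ↥I01} (hZ : Measurable Z)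
    (hΨ : ModNullInverse volume ((volume : Measure ↥I01).prod volume) Ψ Ψ')
    (hZX : ∀ᵐ t ∂(volume : Measure ↥I01), Z (Ψ t).1 = X t) {r : ℕ → ↥I01 → ℝ}
    (hr : ∀ n, Measurable (r n)) (hr1 : ∀ n t, |r n t| ≤ 1)
    (hweak : ∀ f : ↥I01 → ℝ, MemLp f 2 volume → Tendsto (fun n => ∫ t, r n t * f t) atTop (𝓝 0))
    {W : ↥I01 → ↥I01} (hW : Measurable W) :
    Tendsto (fun n => eLpNorm ((volume : Measure ↥I01)[(fun t => r n (Ψ t).2 * (W t : ℝ)) |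
      MeasurableSpace.comap X inferInstance]) 2 volume) atTop (𝓝 0) := by
  have hΨm := hΨ.map_fwd.measurable
  have hWm : Measurable fun p => (W (Ψ' p) : ℝ) := (hW.comp hΨ.map_bwd.measurable).subtype_val
  have hW1 : ∀ t, |(W t : ℝ)| ≤ 1 := fun t => abs_le.2 ⟨by linarith [(W t).2.1], (W t).2.2⟩
  have hrW : ∀ n a t, |r n a * (W t : ℝ)| ≤ 1 := fun n a t => by
    rw [abs_mul]
    exact mul_le_one₀ (hr1 n a) (abs_nonneg _) (hW1 t)
  have hrWm : ∀ n, Measurable fun p : ↥I01 × ↥I01 => r n p.2 * (W (Ψ' p) : ℝ) := fun n =>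
    ((hr n).comp measurable_snd).mul hWm
  let h : ℕ → ↥I01 → ℝ := fun n a => ∫ b, r n b * (W (Ψ' (a, b)) : ℝ)
  have hh : ∀ n, StronglyMeasurable (h n) := fun n =>
    (hrWm n).stronglyMeasurable.integral_prod_right'
  have hh1 : ∀ n a, |h n a| ≤ 1 := fun n a => by
    simpa using norm_integral_le_of_norm_le_const (μ := (volume : Measure ↥I01))
      (f := fun b => r n b * (W (Ψ' (a, b)) : ℝ)) (C := 1) (ae_of_all _ fun b => hrW n b _)
  have hlim : Tendsto (fun n => ∫ a, |h n a|) atTop (𝓝 0) := by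
    have := tendsto_integral_of_dominated_convergence (μ := (volume : Measure ↥I01))
      (F := fun n a => |h n a|) (f := fun _ => 0) (fun _ => 1)
      (fun n => (hh n).norm.aestronglyMeasurable) (integrable_const 1)
      (fun n => ae_of_all _ fun a => by simpa using hh1 n a) (ae_of_all _ fun a => by
        exact (tendsto_zero_iff_abs_tendsto_zero _).1 (hweak _ (.of_bound
          (hWm.comp measurable_prodMk_left).aestronglyMeasurable 1
          (ae_of_all _ fun b => hW1 _))))
    simpa using this
  have hbound : ∀ n, eLpNorm ((volume : Measure ↥I01)[(fun t => r n (Ψ t).2 * (W t : ℝ)) |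
      MeasurableSpace.comap X inferInstance]) 2 volume ≤ ENNReal.ofReal (√(∫ a, |h n a|)) := by
    intro n
    obtain ⟨φ, hφ, hφ1, heq⟩ := exists_condExp_eq_comp hX (f := fun t => r n (Ψ t).2 * (W t : ℝ))
      (((hr n).comp hΨm.snd).mul hW.subtype_val) fun t => hrW n _ _
    rw [heq]
    refine ENNReal.ofReal_le_ofReal (Real.sqrt_le_sqrt ?_)
    have hprodm : Measurable fun p : ↥I01 × ↥I01 => φ (Z p.1) * (r n p.2 * (W (Ψ' p) : ℝ)) :=
      ((hφ.comp hZ).comp measurable_fst).mul (hrWm n)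
    calc ∫ t, φ (X t) * (r n (Ψ t).2 * (W t : ℝ))
        = ∫ t, φ (Z (Ψ t).1) * (r n (Ψ t).2 * (W (Ψ' (Ψ t)) : ℝ)) := by
          refine integral_congr_ae ?_
          filter_upwards [hΨ.left_inv, hZX] with t ht ht'
          rw [ht, ht']
      _ = ∫ p, φ (Z p.1) * (r n p.2 * (W (Ψ' p) : ℝ)) ∂((volume : Measure ↥I01).prod volume) := by
          rw [← hΨ.map_fwd.map_eq, integral_map hΨm.aemeasurable hprodm.aestronglyMeasurable]
      _ = ∫ a, φ (Z a) * h n a := by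
          rw [integral_prod _ (.of_bound hprodm.aestronglyMeasurable 1 (ae_of_all _ fun p => ?_))]
          · exact integral_congr_ae (ae_of_all _ fun a => integral_const_mul (φ (Z a)) _)
          · rw [norm_mul]
            exact mul_le_one₀ (hφ1 _) (norm_nonneg _) (hrW n _ _)
      _ ≤ ∫ a, |h n a| := by
          have hle : ∀ a, |φ (Z a) * h n a| ≤ |h n a| := fun a => by
            rw [abs_mul]
            exact mul_le_of_le_one_left (abs_nonneg _) (hφ1 _)
          have hint : Integrable (h n) (volume : Measure ↥I01) :=
            .of_bound (hh n).aestronglyMeasurable 1 (ae_of_all _ (hh1 n))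
          exact integral_mono (hint.mono
            ((hφ.comp hZ).aestronglyMeasurable.mul (hh n).aestronglyMeasurable)
            (ae_of_all _ hle)) hint.abs fun a => (le_abs_self _).trans (hle a)
  refine tendsto_of_tendsto_of_tendsto_of_le_of_le tendsto_const_nhds ?_ (fun _ => bot_le) hbound
  simpa [Function.comp_def] using
    (ENNReal.continuous_ofReal.tendsto _).comp ((Real.continuous_sqrt.tendsto 0).comp hlim)

end CondExp

section Atoms

variable {X : ↥I01 → ↥I01}

lemma exists_mem_countableBasis_half_measure_singleton_le {α : Type*} [TopologicalSpace α]
    [SecondCountableTopology α] [T1Space α] [MeasurableSpace α] [BorelSpace α]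
    (ρ : Measure α) [IsFiniteMeasure ρ] [ρ.OuterRegular] {y : α} (hy : ρ {y} ≠ 0) :
    ∃ B ∈ TopologicalSpace.countableBasis α, ∀ z : α → ℝ, Measurable z →
      (∀ t, |z t| = 1) → ρ.real {y} / 2 ≤ |∫ t in B, z t ∂ρ| := by
  have hlt : ρ {y} < ρ {y} + ρ {y} / 2 :=
    ENNReal.lt_add_right (measure_ne_top _ _) (by simpa using hy)
  obtain ⟨U, hyU, hU, hρU⟩ := Set.exists_isOpen_lt_of_lt {y} _ hlt
  obtain ⟨B, hB, hyB, hBU⟩ := (TopologicalSpace.isBasis_countableBasis α).exists_subset_of_mem_open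
    (hyU rfl) hU
  refine ⟨B, hB, fun z hz hz1 => ?_⟩
  have hBm : MeasurableSet B := (TopologicalSpace.isOpen_of_mem_countableBasis hB).measurableSet
  have hBsub : {y} ⊆ B := Set.singleton_subset_iff.2 hyB
  have hρB : ρ.real B ≤ ρ.real {y} + ρ.real {y} / 2 := by
    have := ENNReal.toReal_mono (by finiteness) ((measure_mono hBU).trans hρU.le)
    rwa [ENNReal.toReal_add (by finiteness) (by finiteness), ENNReal.toReal_div] at this
  have hdiff : ρ.real (B \ {y}) ≤ ρ.real {y} / 2 := by
    rw [measureReal_sdiff hBsub (measurableSet_singleton y)]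
    linarith
  have hint : Integrable z ρ := .of_bound hz.aestronglyMeasurable 1
    (ae_of_all _ fun t => (hz1 t).le)
  have hsplit := setIntegral_sdiff (measurableSet_singleton y) hint.integrableOn hBsub
  have hsmall := norm_setIntegral_le_of_norm_le_const (μ := ρ) (s := B \ {y}) (f := z) (C := 1)
    (by finiteness) fun t _ => (hz1 t).le
  have hbig : |∫ t in {y}, z t ∂ρ| = ρ.real {y} := by
    rw [integral_singleton, smul_eq_mul, abs_mul, hz1, mul_one, abs_of_nonneg measureReal_nonneg]
  rw [Real.norm_eq_abs, hsplit, one_mul, abs_sub_comm] at hsmall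
  have := abs_sub_abs_le_abs_sub (∫ t in {y}, z t ∂ρ) (∫ t in B, z t ∂ρ)
  linarith

lemma ae_condDistrib_singleton_eq_zero (hX : Measurable X) {Z : ℕ → ↥I01 → ℝ}
    (hZ : ∀ n, Measurable (Z n)) (hZ1 : ∀ n t, |Z n t| = 1)
    (hlim : ∀ W : ↥I01 → ↥I01, Measurable W → Tendsto (fun n =>
      eLpNorm ((volume : Measure ↥I01)[(fun t => Z n t * (W t : ℝ)) |
        MeasurableSpace.comap X inferInstance]) 2 volume) atTop (𝓝 0)) :
    ∀ᵐ x ∂(Measure.map X volume), ∀ y, condDistrib id X volume x {y} = 0 := by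
  have hset : ∀ B ∈ TopologicalSpace.countableBasis ↥I01, ∀ᵐ x ∂(Measure.map X volume),
      liminf (fun n => ‖∫ t in B, Z n t ∂(condDistrib id X volume x)‖ₑ) atTop = 0 := by
    intro B hB
    have hBm : MeasurableSet B := (TopologicalSpace.isOpen_of_mem_countableBasis hB).measurableSet
    have hmeas : ∀ n, Measurable fun x => ∫ t in B, Z n t ∂(condDistrib id X volume x) := by
      intro n
      simp_rw [← integral_indicator hBm]
      exact (StronglyMeasurable.integral_condDistrib
        (f := fun p : ↥I01 × ↥I01 => B.indicator (Z n) p.2)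
        (((hZ n).indicator hBm).comp measurable_snd).stronglyMeasurable).measurable
    let W : ↥I01 → ↥I01 := B.indicator 1
    have hle : ∀ n, ∫⁻ x, ‖∫ t in B, Z n t ∂(condDistrib id X volume x)‖ₑ ∂(Measure.map X volume) ≤
        eLpNorm ((volume : Measure ↥I01)[(fun t => Z n t * (W t : ℝ)) |
          MeasurableSpace.comap X inferInstance]) 2 volume := by
      intro n
      have hprod : (fun t => Z n t * (W t : ℝ)) = B.indicator (Z n) := by
        ext t
        by_cases ht : t ∈ B <;> simp [W, ht]
      have hint : Integrable (B.indicator (Z n)) (volume : Measure ↥I01) :=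
        (Integrable.of_bound (hZ n).aestronglyMeasurable 1
          (ae_of_all _ fun t => (hZ1 n t).le)).indicator hBm
      rw [hprod, eLpNorm_congr_ae (condExp_ae_eq_integral_condDistrib_id hX hint),
        lintegral_map (hmeas n).enorm hX]
      simp_rw [integral_indicator hBm]
      rw [← eLpNorm_one_eq_lintegral_enorm]
      exact eLpNorm_le_eLpNorm_of_exponent_le one_le_two ((hmeas n).comp hX).aestronglyMeasurable
    have hzero : ∫⁻ x, liminf (fun n => ‖∫ t in B, Z n t ∂(condDistrib id X volume x)‖ₑ) atTop
        ∂(Measure.map X volume) = 0 := by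
      refine le_antisymm ((lintegral_liminf_le fun n => (hmeas n).enorm).trans ?_) (bot_le)
      exact (tendsto_of_tendsto_of_tendsto_of_le_of_le tendsto_const_nhds
        (hlim W (measurable_one.indicator hBm)) (fun _ => bot_le) hle).liminf_eq.le
    exact (lintegral_eq_zero_iff (.liminf fun n => (hmeas n).enorm)).1 hzero
  filter_upwards [(ae_ball_iff (TopologicalSpace.countable_countableBasis _)).2 hset] with x hx y
  by_contra hy
  obtain ⟨B, hB, hle⟩ := exists_mem_countableBasis_half_measure_singleton_le _ hy
  have hpos : 0 < ENNReal.ofReal ((condDistrib id X volume x).real {y} / 2) :=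
    ENNReal.ofReal_pos.2 (half_pos (ENNReal.toReal_pos hy (by finiteness)))
  refine hpos.not_ge ((le_liminf_of_le (by isBoundedDefault)
    (Eventually.of_forall fun n => ?_)).trans (hx B hB).le)
  rw [← ofReal_norm]
  exact ENNReal.ofReal_le_ofReal (hle _ (hZ n) (hZ1 n))

end Atoms

/-- Let `λ` be Lebesgue measure on `[0,1]` (the volume measure on the
subtype `[0,1] ⊆ ℝ`) and `X : [0,1] → [0,1]` Borel measurable.  Write `μ_X = λ ∘ X⁻¹`,
`μ_{X,Y}` for the pushforward of `λ` under `t ↦ (X t, t)`, and `ν = μ_{X,Y}.condKernel`.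
Then the following are equivalent:
(1) for `μ_X`-a.e. `x` the measure `ν x` is atomless;
(2) there is a mod-null isomorphism `Φ : ([0,1], λ) → ([0,1]², μ_X × λ)` with `π₁ ∘ Φ = X` a.e.;
(3) there is a mod-null isomorphism `Ψ : ([0,1], λ) → ([0,1]², λ × λ)` with `X ∘ π₁ ∘ Ψ = X` a.e.;
(4) there are a mod-null isomorphism `Ψ` as in (3) and a Borel `Z : [0,1] → [0,1]` with
    `Z ∘ π₁ ∘ Ψ = X` a.e.;
(5) there are Borel `Z_n : [0,1] → {−1,1}` such that for every Borel `W : [0,1] → [0,1]`,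
    `‖E[Z_n · W | σ(X)]‖_{L²(λ)} → 0`. -/
theorem diffuse_fibers_tfae
    (X : ↥I01 → ↥I01) (hX : Measurable X)
    (μXY : Measure (↥I01 × ↥I01)) [IsProbabilityMeasure μXY]
    (hμXY : μXY = Measure.map (fun t => (X t, t)) volume) :
    List.TFAE
      [ (∀ᵐ x ∂(Measure.map X volume), ∀ y : ↥I01, μXY.condKernel x {y} = 0),
        (∃ (Φ : ↥I01 → ↥I01 × ↥I01) (Φ' : ↥I01 × ↥I01 → ↥I01),
          MeasurePreserving Φ volume ((Measure.map X volume).prod volume) ∧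
          MeasurePreserving Φ' ((Measure.map X volume).prod volume) volume ∧
          (∀ᵐ t ∂(volume : Measure ↥I01), Φ' (Φ t) = t) ∧
          (∀ᵐ p ∂((Measure.map X volume).prod volume), Φ (Φ' p) = p) ∧
          (∀ᵐ t ∂(volume : Measure ↥I01), (Φ t).1 = X t)),
        (∃ (Ψ : ↥I01 → ↥I01 × ↥I01) (Ψ' : ↥I01 × ↥I01 → ↥I01),
          MeasurePreserving Ψ volume ((volume : Measure ↥I01).prod volume) ∧
          MeasurePreserving Ψ' ((volume : Measure ↥I01).prod volume) volume ∧
          (∀ᵐ t ∂(volume : Measure ↥I01), Ψ' (Ψ t) = t) ∧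
          (∀ᵐ p ∂((volume : Measure ↥I01).prod volume), Ψ (Ψ' p) = p) ∧
          (∀ᵐ t ∂(volume : Measure ↥I01), X (Ψ t).1 = X t)),
        (∃ (Ψ : ↥I01 → ↥I01 × ↥I01) (Ψ' : ↥I01 × ↥I01 → ↥I01) (Z : ↥I01 → ↥I01),
          Measurable Z ∧
          MeasurePreserving Ψ volume ((volume : Measure ↥I01).prod volume) ∧
          MeasurePreserving Ψ' ((volume : Measure ↥I01).prod volume) volume ∧
          (∀ᵐ t ∂(volume : Measure ↥I01), Ψ' (Ψ t) = t) ∧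
          (∀ᵐ p ∂((volume : Measure ↥I01).prod volume), Ψ (Ψ' p) = p) ∧
          (∀ᵐ t ∂(volume : Measure ↥I01), Z (Ψ t).1 = X t)),
        (∃ Z : ℕ → ↥I01 → ℝ,
          (∀ n, Measurable (Z n)) ∧
          (∀ n t, Z n t = 1 ∨ Z n t = -1) ∧
          ∀ W : ↥I01 → ↥I01, Measurable W →
            Tendsto (fun n =>
                eLpNorm
                  ((volume : Measure ↥I01)[(fun t => Z n t * (W t : ℝ)) |
                    MeasurableSpace.comap X inferInstance]) 2 volume)
              atTop (𝓝 0)) ] := by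
  subst hμXY
  have hκ : Measure.map X volume ⊗ₘ condDistrib id X volume =
      Measure.map (fun t => (X t, t)) volume := compProd_map_condDistrib aemeasurable_id
  have hker : (Measure.map (fun t => (X t, t)) volume).condKernel = condDistrib id X volume :=
    (condDistrib_def id X volume).symm
  rw [hker]
  have : IsProbabilityMeasure (Measure.map X (volume : Measure ↥I01)) :=
    Measure.isProbabilityMeasure_map hX.aemeasurable
  tfae_have 1 → 2 := fun h =>
    let ⟨Φ, Φ', hΦ, hfst⟩ := exists_modNullInverse_prod hX _ hκ h
    ⟨Φ, Φ', hΦ.map_fwd, hΦ.map_bwd, hΦ.left_inv, hΦ.right_inv, hfst⟩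
  tfae_have 2 → 3 := fun ⟨_, _, hf, hb, hl, hr, hfst⟩ =>
    let ⟨Ψ, Ψ', hΨ, h⟩ := exists_modNullInverse_volume_prod ⟨hf, hb, hl, hr⟩ hfst
    ⟨Ψ, Ψ', hΨ.map_fwd, hΨ.map_bwd, hΨ.left_inv, hΨ.right_inv, h⟩
  tfae_have 3 → 4 := fun ⟨Ψ, Ψ', h⟩ => ⟨Ψ, Ψ', X, hX, h⟩
  tfae_have 4 → 5 := fun ⟨Ψ, _, _, hZ, hf, hb, hl, hr, hZX⟩ =>
    let ⟨r, hrm, hsign, hweak⟩ := exists_weakly_null_signs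
    ⟨fun n t => r n (Ψ t).2, fun n => (hrm n).comp hf.measurable.snd, fun n t => hsign n _,
      fun _ hW => tendsto_condExp_of_modNullInverse hX hZ ⟨hf, hb, hl, hr⟩ hZX hrm
        (fun n t => by rcases hsign n t with h | h <;> simp [h]) hweak hW⟩
  tfae_have 5 → 1 := fun ⟨_, hZ, hsign, hlim⟩ =>
    ae_condDistrib_singleton_eq_zero hX hZ
      (fun n t => by rcases hsign n t with h | h <;> simp [h]) hlim
  tfae_finish
end

section
/- Let λ denote Lebesgue measure on [0,1] and let X : [0,1] → [0,1] be Borel measurable. Suppose there exists a mod-null isomorphism Φ from ([0,1], λ) to ([0,1] × [0,1], μ_X × λ) such that π₁ ∘ Φ = X λ-a.e. Then there exists a mod-null isomorphism Ψ from ([0,1], λ) to ([0,1] × [0,1], λ × λ) such that X ∘ π₁ ∘ Ψ = X λ-a.e. -/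
open MeasureTheory Filter
open scoped ENNReal Topology

local notation "I01" => Set.Icc (0:ℝ) 1

/-- The cumulative distribution function of a probability measure without atoms is continuous. -/
lemma ProbabilityTheory.continuous_cdf (μ : Measure ℝ) [IsProbabilityMeasure μ] [NullSingletonClass μ] :
    Continuous (ProbabilityTheory.cdf μ) := by
  refine continuous_iff_continuousAt.2 fun x => ?_
  have hmono := ProbabilityTheory.monotone_cdf μ
  rw [hmono.continuousAt_iff_leftLim_eq_rightLim, StieltjesFunction.rightLim_eq]
  have h : (ProbabilityTheory.cdf μ).measure {x} = 0 := by
    rw [ProbabilityTheory.measure_cdf, measure_singleton]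
  rw [StieltjesFunction.measure_singleton, ENNReal.ofReal_eq_zero, sub_nonpos] at h
  exact le_antisymm (hmono.leftLim_le le_rfl) h

/-- A mod-null isomorphism between two measure spaces: a pair of measure-preserving maps which
are almost everywhere inverse to each other. -/
structure IsModNullIso {α β : Type*} [MeasurableSpace α] [MeasurableSpace β]
    (f : α → β) (g : β → α) (μ : Measure α) (ν : Measure β) : Prop where
  measurePreserving : MeasurePreserving f μ ν
  measurePreserving_inv : MeasurePreserving g ν μ
  left_inv : ∀ᵐ x ∂μ, g (f x) = x
  right_inv : ∀ᵐ y ∂ν, f (g y) = y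

namespace IsModNullIso

variable {α β γ δ : Type*} [MeasurableSpace α] [MeasurableSpace β] [MeasurableSpace γ]
  [MeasurableSpace δ] {μ : Measure α} {ν : Measure β} {ρ : Measure γ} {τ : Measure δ}

lemma symm {f : α → β} {g : β → α} (h : IsModNullIso f g μ ν) : IsModNullIso g f ν μ :=
  ⟨h.measurePreserving_inv, h.measurePreserving, h.right_inv, h.left_inv⟩

lemma trans {f : α → β} {g : β → α} {f' : β → γ} {g' : γ → β}
    (h : IsModNullIso f g μ ν) (h' : IsModNullIso f' g' ν ρ) :
    IsModNullIso (f' ∘ f) (g ∘ g') μ ρ where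
  measurePreserving := h'.measurePreserving.comp h.measurePreserving
  measurePreserving_inv := h.measurePreserving_inv.comp h'.measurePreserving_inv
  left_inv := by
    filter_upwards [h.left_inv,
      h.measurePreserving.quasiMeasurePreserving.ae h'.left_inv] with x hx hx'
    simp [hx, hx']
  right_inv := by
    filter_upwards [h'.right_inv,
      h'.measurePreserving_inv.quasiMeasurePreserving.ae h.right_inv] with x hx hx'
    simp [hx, hx']

lemma prodMap [SFinite μ] [SFinite ν] [SFinite ρ] [SFinite τ] {f : α → β} {g : β → α}
    {f' : γ → δ} {g' : δ → γ} (h : IsModNullIso f g μ ν) (h' : IsModNullIso f' g' ρ τ) :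
    IsModNullIso (Prod.map f f') (Prod.map g g') (μ.prod ρ) (ν.prod τ) where
  measurePreserving := h.measurePreserving.prod h'.measurePreserving
  measurePreserving_inv := h.measurePreserving_inv.prod h'.measurePreserving_inv
  left_inv := by
    filter_upwards [Measure.quasiMeasurePreserving_fst.ae h.left_inv,
      Measure.quasiMeasurePreserving_snd.ae h'.left_inv] with x hx hx'
    exact Prod.ext hx hx'
  right_inv := by
    filter_upwards [Measure.quasiMeasurePreserving_fst.ae h.right_inv,
      Measure.quasiMeasurePreserving_snd.ae h'.right_inv] with x hx hx'
    exact Prod.ext hx hx'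

lemma id (μ : Measure α) : IsModNullIso _root_.id _root_.id μ μ :=
  ⟨.id μ, .id μ, ae_of_all _ fun _ => rfl, ae_of_all _ fun _ => rfl⟩

lemma _root_.MeasureTheory.MeasurePreserving.isModNullIso (e : α ≃ᵐ β)
    (h : MeasurePreserving e μ ν) : IsModNullIso e e.symm μ ν :=
  ⟨h, h.symm e, ae_of_all _ e.symm_apply_apply, ae_of_all _ e.apply_symm_apply⟩

end IsModNullIso

/-- Lebesgue measure on `[0,1]` is mod-null isomorphic to every atomless probability measure on
`[0,1]`, by the quantile function and the cumulative distribution function. -/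
lemma exists_isModNullIso_unitInterval (ν : Measure I01) [IsProbabilityMeasure ν] [NullSingletonClass ν] :
    ∃ (G : I01 → I01) (F : I01 → I01), IsModNullIso G F volume ν := by
  have hemb : MeasurableEmbedding ((↑) : I01 → ℝ) := unitInterval.measurableEmbedding_coe
  let m : Measure ℝ := ν.map (↑)
  have : IsProbabilityMeasure m := Measure.isProbabilityMeasure_map hemb.measurable.aemeasurable
  have : NullSingletonClass m := ⟨fun x => by
    rw [hemb.map_apply]
    exact (Set.subsingleton_singleton.preimage Subtype.val_injective).measure_zero ν⟩
  let F : I01 → I01 := fun x =>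
    ⟨ProbabilityTheory.cdf m x, ProbabilityTheory.cdf_nonneg m x, ProbabilityTheory.cdf_le_one m x⟩
  have hFcont : Continuous F :=
    ((ProbabilityTheory.continuous_cdf m).comp continuous_subtype_val).subtype_mk _
  have hFmono : Monotone F := fun x y hxy => ProbabilityTheory.monotone_cdf m hxy
  have hFν (x : I01) : ν (Set.Iic x) = ENNReal.ofReal (F x) := by
    rw [ProbabilityTheory.ofReal_cdf, hemb.map_apply]
    rfl
  have hF0 : F 0 = 0 := by
    have h := hFν 0
    have h0 : Set.Iic (0 : I01) = {0} := Set.Iic_bot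
    rw [h0, measure_singleton, eq_comm, ENNReal.ofReal_eq_zero] at h
    exact le_antisymm h bot_le
  have hF1 : F 1 = 1 := by
    have h := hFν 1
    have h1 : Set.Iic (1 : I01) = Set.univ := Set.Iic_top
    rw [h1, measure_univ, eq_comm, ENNReal.ofReal_eq_one] at h
    exact Subtype.ext h
  have hFsurj (u : I01) : ∃ y, F y = u := by
    have h := intermediate_value_univ (0 : I01) 1 hFcont
    rw [hF0, hF1] at h
    exact h ⟨bot_le, le_top⟩
  let G : I01 → I01 := fun u => sInf {x | u ≤ F x}
  have hG_mem (u : I01) : u ≤ F (G u) :=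
    (isClosed_le continuous_const hFcont).sInf_mem
      ((hFsurj u).imp fun y hy => hy.ge)
  have hGF (u x : I01) : G u ≤ x ↔ u ≤ F x :=
    ⟨fun h => (hG_mem u).trans (hFmono h), fun h => sInf_le h⟩
  have hFG (u : I01) : F (G u) = u := by
    obtain ⟨y, hy⟩ := hFsurj u
    exact le_antisymm ((hFmono ((hGF u y).2 hy.ge)).trans hy.le) (hG_mem u)
  have hpre (x : I01) : G ⁻¹' Set.Iic x = Set.Iic (F x) := Set.ext fun u => hGF u x
  have hGmeas : Measurable G := measurable_of_Iic fun x => hpre x ▸ measurableSet_Iic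
  have hGpres : MeasurePreserving G volume ν := by
    refine ⟨hGmeas, ?_⟩
    have : IsProbabilityMeasure (Measure.map G volume) :=
      Measure.isProbabilityMeasure_map hGmeas.aemeasurable
    refine Measure.ext_of_Iic _ _ fun x => ?_
    rw [Measure.map_apply hGmeas measurableSet_Iic, hpre, hFν]
    exact unitInterval.volume_Iic (F x)
  refine ⟨G, F, hGpres, ⟨hFcont.measurable, ?_⟩, ae_of_all _ hFG, ?_⟩
  · rw [← hGpres.map_eq, Measure.map_map hFcont.measurable hGmeas,
      show F ∘ G = _root_.id from funext hFG, Measure.map_id]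
  · rw [← hGpres.map_eq]
    exact (ae_map_iff hGmeas.aemeasurable
      (measurableSet_eq_fun (hGmeas.comp hFcont.measurable) measurable_id)).2
      (ae_of_all _ fun u => congrArg G (hFG u))

/-- Lebesgue measure on `[0,1]` is mod-null isomorphic to every atomless probability measure on
a standard Borel space. -/
lemma exists_isModNullIso_of_nullSingletonClass {α : Type*} [MeasurableSpace α] [StandardBorelSpace α]
    (μ : Measure α) [IsProbabilityMeasure μ] [NullSingletonClass μ] :
    ∃ (f : I01 → α) (g : α → I01), IsModNullIso f g volume μ := by
  have hα : ¬ Countable α := fun _ => by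
    simpa using (Set.countable_univ (α := α)).measure_zero μ
  have hI : ¬ Countable I01 := fun h => by
    simpa using (Set.countable_univ (α := I01)).measure_zero volume
  let e : α ≃ᵐ I01 := PolishSpace.measurableEquivOfNotCountable hα hI
  have : IsProbabilityMeasure (μ.map e) :=
    Measure.isProbabilityMeasure_map e.measurable.aemeasurable
  have : NullSingletonClass (μ.map e) := ⟨fun x => by
    rw [e.map_apply]
    exact (Set.subsingleton_singleton.preimage e.injective).measure_zero μ⟩
  obtain ⟨G, F, h⟩ := exists_isModNullIso_unitInterval (μ.map e)
  have he : MeasurePreserving e μ (μ.map e) := ⟨e.measurable, rfl⟩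
  exact ⟨_, _, h.trans he.isModNullIso.symm⟩

/-- Let `λ` be Lebesgue measure on `[0,1]` (the volume measure on the
subtype `[0,1] ⊆ ℝ`) and `X : [0,1] → [0,1]` Borel measurable.  If there is a mod-null
isomorphism `Φ : ([0,1], λ) → ([0,1]², μ_X × λ)` with `π₁ ∘ Φ = X` λ-a.e., then there is a
mod-null isomorphism `Ψ : ([0,1], λ) → ([0,1]², λ × λ)` with `X ∘ π₁ ∘ Ψ = X` λ-a.e. -/
theorem modNullIso_over_pushforward_implies_modNullIso_square
    (X : ↥I01 → ↥I01) (hX : Measurable X)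
    (h2 : ∃ (Φ : ↥I01 → ↥I01 × ↥I01) (Φ' : ↥I01 × ↥I01 → ↥I01),
      MeasurePreserving Φ volume ((Measure.map X volume).prod volume) ∧
      MeasurePreserving Φ' ((Measure.map X volume).prod volume) volume ∧
      (∀ᵐ t ∂(volume : Measure ↥I01), Φ' (Φ t) = t) ∧
      (∀ᵐ p ∂((Measure.map X volume).prod volume), Φ (Φ' p) = p) ∧
      (∀ᵐ t ∂(volume : Measure ↥I01), (Φ t).1 = X t)) :
    ∃ (Ψ : ↥I01 → ↥I01 × ↥I01) (Ψ' : ↥I01 × ↥I01 → ↥I01),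
      MeasurePreserving Ψ volume ((volume : Measure ↥I01).prod volume) ∧
      MeasurePreserving Ψ' ((volume : Measure ↥I01).prod volume) volume ∧
      (∀ᵐ t ∂(volume : Measure ↥I01), Ψ' (Ψ t) = t) ∧
      (∀ᵐ p ∂((volume : Measure ↥I01).prod volume), Ψ (Ψ' p) = p) ∧
      (∀ᵐ t ∂(volume : Measure ↥I01), X (Ψ t).1 = X t) := by
  obtain ⟨Φ, Φ', hΦ, hΦ', hl, hr, hfst⟩ := h2
  have : IsProbabilityMeasure (Measure.map X volume) :=
    Measure.isProbabilityMeasure_map hX.aemeasurable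
  have h : IsModNullIso Φ Φ' volume ((Measure.map X volume).prod volume) := ⟨hΦ, hΦ', hl, hr⟩
  obtain ⟨σ, σ', hσ⟩ := exists_isModNullIso_of_nullSingletonClass
    ((volume : Measure ↥I01).prod (volume : Measure ↥I01))
  have hassoc := (measurePreserving_prodAssoc (Measure.map X volume)
    (volume : Measure ↥I01) (volume : Measure ↥I01)).isModNullIso.symm
  have hmid := ((IsModNullIso.id (Measure.map X volume)).prodMap hσ).trans hassoc
  have hΨ := (h.trans hmid).trans (h.symm.prodMap (IsModNullIso.id (volume : Measure ↥I01)))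
  refine ⟨_, _, hΨ.1, hΨ.2, hΨ.3, hΨ.4, ?_⟩
  have hXΦ' : ∀ᵐ p ∂((Measure.map X volume).prod volume), X (Φ' p) = p.1 := by
    filter_upwards [hr, hΦ'.quasiMeasurePreserving.ae hfst] with p hp hp'
    rw [← hp', hp]
  have hmp := Measure.quasiMeasurePreserving_fst.comp
    (h.trans hmid).measurePreserving.quasiMeasurePreserving
  filter_upwards [hfst, hmp.ae hXΦ'] with t ht ht'
  exact ht'.trans ht
end

section
/- Let λ denote Lebesgue measure on [0,1] and let X : [0,1] → [0,1] be Borel measurable. Suppose there exist a mod-null isomorphism Ψ from ([0,1], λ) to ([0,1] × [0,1], λ × λ) and a Borel measurable map Z : [0,1] → [0,1] such that Z ∘ π₁ ∘ Ψ = X λ-a.e. Then there exists a sequence of Borel measurable functions Z_n : [0,1] → ℝ taking values in {−1, 1} such that for every Borel measurable W : [0,1] → [0,1], ‖E[Z_n · W | σ(X)]‖_{L²(λ)} → 0 as n → ∞. -/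
open MeasureTheory Filter
open scoped ENNReal Topology

local notation "I01" => Set.Icc (0:ℝ) 1

/-- The Rademacher function of dyadic scale `2⁻ⁿ`, extended periodically to `ℝ`. -/
noncomputable def rademacher (n : ℕ) (y : ℝ) : ℝ := (-1) ^ ⌊(2 : ℝ) ^ n * y⌋

lemma rademacher_eq_one_or (n : ℕ) (y : ℝ) : rademacher n y = 1 ∨ rademacher n y = -1 := by
  unfold rademacher
  rcases Int.even_or_odd ⌊(2 : ℝ) ^ n * y⌋ with h | h
  · exact Or.inl h.neg_one_zpow
  · exact Or.inr h.neg_one_zpow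

lemma abs_rademacher (n : ℕ) (y : ℝ) : |rademacher n y| = 1 := by
  rcases rademacher_eq_one_or n y with h | h <;> simp [h]

lemma rademacher_mul_self (n : ℕ) (y : ℝ) : rademacher n y * rademacher n y = 1 := by
  rcases rademacher_eq_one_or n y with h | h <;> simp [h]

lemma measurable_rademacher (n : ℕ) : Measurable (rademacher n) :=
  (Measurable.of_discrete (f := fun k : ℤ => (-1 : ℝ) ^ k)).comp
    (Int.measurable_floor.comp (measurable_const_mul _))

lemma rademacher_antiperiodic (n : ℕ) : Function.Antiperiodic (rademacher n) ((2 : ℝ) ^ n)⁻¹ := by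
  intro y
  have h : (2 : ℝ) ^ n * (y + ((2 : ℝ) ^ n)⁻¹) = 2 ^ n * y + 1 := by field_simp
  rw [rademacher, h, Int.floor_add_one, zpow_add₀ (by norm_num)]
  simp [rademacher]

lemma rademacher_periodic {n m : ℕ} (h : n < m) :
    Function.Periodic (rademacher m) ((2 : ℝ) ^ n)⁻¹ := by
  obtain ⟨k, rfl⟩ := Nat.exists_eq_add_of_lt h
  have hk : ((2 : ℝ) ^ n)⁻¹ = ((2 ^ k : ℕ) : ℝ) * (2 * ((2 : ℝ) ^ (n + k + 1))⁻¹) := by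
    push_cast [pow_add]
    field_simp
  rw [hk]
  exact (rademacher_antiperiodic (n + k + 1)).periodic_two_mul.nat_mul (2 ^ k)

lemma integral_rademacher_mul {n m : ℕ} (h : n < m) (hn : 0 < n) :
    ∫ y in (0 : ℝ)..1, rademacher n y * rademacher m y = 0 := by
  have hp : Function.Periodic (fun y => rademacher n y * rademacher m y) 1 := by
    have h1 : Function.Periodic (rademacher n) 1 := by simpa using rademacher_periodic hn
    have h2 : Function.Periodic (rademacher m) 1 := by
      simpa using rademacher_periodic (hn.trans h)
    exact h1.mul h2
  have ht := hp.intervalIntegral_add_eq ((2 : ℝ) ^ n)⁻¹ 0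
  have hs := intervalIntegral.integral_comp_add_right (a := 0) (b := 1)
    (fun y => rademacher n y * rademacher m y) ((2 : ℝ) ^ n)⁻¹
  simp only [rademacher_antiperiodic n _, rademacher_periodic h _, neg_mul,
    intervalIntegral.integral_neg] at hs
  rw [zero_add, add_comm 1, ht, zero_add] at hs
  linarith

lemma memLp_two_rademacher (n : ℕ) :
    MemLp (fun y : ↥I01 => rademacher n y) 2 volume :=
  MemLp.of_bound ((measurable_rademacher n).comp measurable_subtype_coe).aestronglyMeasurable 1
    (ae_of_all _ fun y => by simp [abs_rademacher])

lemma inner_toLp_real {α : Type*} [MeasurableSpace α] {μ : Measure α} {f g : α → ℝ}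
    (hf : MemLp f 2 μ) (hg : MemLp g 2 μ) :
    inner ℝ (hf.toLp f) (hg.toLp g) = ∫ a, f a * g a ∂μ := by
  rw [L2.inner_def]
  refine integral_congr_ae ?_
  filter_upwards [hf.coeFn_toLp, hg.coeFn_toLp] with a h1 h2
  simp [h1, h2, mul_comm]

lemma orthonormal_rademacher :
    Orthonormal ℝ fun n : ℕ => (memLp_two_rademacher (n + 1)).toLp := by
  have key : ∀ n m : ℕ, n < m → ∫ y : ↥I01, rademacher (n + 1) y * rademacher (m + 1) y = 0 := by
    intro n m h
    rw [integral_subtype measurableSet_Icc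
      (fun y : ℝ => rademacher (n + 1) y * rademacher (m + 1) y), integral_Icc_eq_integral_Ioc,
      ← intervalIntegral.integral_of_le zero_le_one]
    exact integral_rademacher_mul (by omega) (by omega)
  rw [orthonormal_iff_ite]
  intro n m
  rw [inner_toLp_real]
  split_ifs with h
  · subst h
    simp [rademacher_mul_self]
  · rcases lt_or_gt_of_ne h with h | h
    · exact key n m h
    · simpa only [mul_comm] using key m n h

/-- The Rademacher functions converge weakly to zero in `L²`. -/
lemma tendsto_integral_rademacher_mul {f : ↥I01 → ℝ} (hf : MemLp f 2 volume) :
    Tendsto (fun n : ℕ => ∫ y : ↥I01, rademacher (n + 1) y * f y) atTop (𝓝 0) := by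
  have h := (orthonormal_rademacher.inner_products_summable (hf.toLp f)).tendsto_atTop_zero
  simp only [inner_toLp_real] at h
  have h2 := h.sqrt
  simp only [Real.sqrt_sq (norm_nonneg _), Real.sqrt_zero] at h2
  exact tendsto_zero_iff_norm_tendsto_zero.2 h2

/-- Fibrewise weak convergence of the Rademacher functions, integrated over the base. -/
lemma tendsto_integral_abs_integral_rademacher_mul {α : Type*} [MeasurableSpace α]
    {μ : Measure α} [IsFiniteMeasure μ] {w : α × ↥I01 → ℝ} (hw : Measurable w)
    (hw1 : ∀ p, |w p| ≤ 1) :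
    Tendsto (fun n : ℕ => ∫ x, |∫ y : ↥I01, rademacher (n + 1) y * w (x, y)| ∂μ) atTop (𝓝 0) := by
  have hm : ∀ n : ℕ, Measurable fun p : α × ↥I01 => rademacher (n + 1) p.2 * w p := fun n =>
    ((measurable_rademacher _).comp (measurable_subtype_coe.comp measurable_snd)).mul hw
  suffices h : Tendsto (fun n : ℕ => ∫ x, |∫ y : ↥I01, rademacher (n + 1) y * w (x, y)| ∂μ)
      atTop (𝓝 (∫ _, 0 ∂μ)) by simpa only [integral_zero] using h
  refine tendsto_integral_of_dominated_convergence (fun _ => 1) (fun n => ?_)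
    (integrable_const _) (fun n => ae_of_all _ fun x => ?_) (ae_of_all _ fun x => ?_)
  · exact (hm n).stronglyMeasurable.integral_prod_right'.norm.aestronglyMeasurable
  · rw [Real.norm_eq_abs, abs_abs]
    have := norm_integral_le_of_norm_le_const (μ := (volume : Measure ↥I01)) (C := 1)
      (f := fun y : ↥I01 => rademacher (n + 1) y * w (x, y))
      (ae_of_all _ fun y => by simpa [abs_mul, abs_rademacher] using hw1 (x, y))
    simpa using this
  · have hf : MemLp (fun y => w (x, y)) 2 (volume : Measure ↥I01) :=
      MemLp.of_bound (hw.comp measurable_prodMk_left).aestronglyMeasurable 1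
        (ae_of_all _ fun y => hw1 (x, y))
    simpa using (tendsto_integral_rademacher_mul hf).abs

/-- The integral of `b x * h (x, y)` with `|b| ≤ 1` is at most that of the absolute fibre
integrals of `h`. -/
lemma integral_prod_mul_le {α β : Type*} [MeasurableSpace α] [MeasurableSpace β]
    {μ : Measure α} {ν : Measure β} [IsFiniteMeasure μ] [IsFiniteMeasure ν]
    {b : α → ℝ} (hb : Measurable b) (hb1 : ∀ x, |b x| ≤ 1)
    {h : α × β → ℝ} (hh : Measurable h) (hh1 : ∀ p, |h p| ≤ 1) :
    ∫ p, b p.1 * h p ∂(μ.prod ν) ≤ ∫ x, |∫ y, h (x, y) ∂ν| ∂μ := by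
  have hint : Integrable (fun p : α × β => b p.1 * h p) (μ.prod ν) :=
    Integrable.of_bound ((hb.comp measurable_fst).mul hh).aestronglyMeasurable 1
      (ae_of_all _ fun p => by
        rw [Real.norm_eq_abs, abs_mul]
        exact mul_le_one₀ (hb1 _) (abs_nonneg _) (hh1 _))
  have hint' : Integrable h (μ.prod ν) :=
    Integrable.of_bound hh.aestronglyMeasurable 1 (ae_of_all _ hh1)
  rw [integral_prod _ hint]
  refine integral_mono hint.integral_prod_left hint'.integral_prod_left.abs fun x => ?_
  dsimp only
  rw [integral_const_mul]
  calc b x * ∫ y, h (x, y) ∂ν ≤ |b x * ∫ y, h (x, y) ∂ν| := le_abs_self _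
    _ ≤ |∫ y, h (x, y) ∂ν| := by
      rw [abs_mul]
      exact mul_le_of_le_one_left (abs_nonneg _) (hb1 x)

/-- For `|f| ≤ 1`, the squared `L²` norm of `E[f | σ(X)]` is the integral of `f` against some
measurable function of `X` bounded by one. -/
lemma exists_integral_sq_condExp_comap {Ω E : Type*} [MeasurableSpace Ω] [MeasurableSpace E]
    {μ : Measure Ω} [IsFiniteMeasure μ] {X : Ω → E} (hX : Measurable X)
    {f : Ω → ℝ} (hf : Measurable f) (hf1 : ∀ t, |f t| ≤ 1) :
    ∃ φ : E → ℝ, Measurable φ ∧ (∀ e, |φ e| ≤ 1) ∧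
      ∫ t, (μ[f | MeasurableSpace.comap X inferInstance]) t ^ 2 ∂μ = ∫ t, φ (X t) * f t ∂μ := by
  set m : MeasurableSpace Ω := MeasurableSpace.comap X inferInstance
  have hbd : ∀ᵐ t ∂μ, |(μ[f | m]) t| ≤ 1 :=
    ae_bdd_abs_condExp_of_ae_bdd_abs (R := 1) (ae_of_all _ hf1)
  have hfi : Integrable f μ := Integrable.of_bound hf.aestronglyMeasurable 1 (ae_of_all _ hf1)
  obtain ⟨φ, hφ, hφX⟩ :=
    (stronglyMeasurable_condExp (f := f) (m := m) (μ := μ)).exists_eq_measurable_comp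
  refine ⟨fun e => max (-1) (min (φ e) 1),
    measurable_const.max (hφ.measurable.min measurable_const),
    fun e => abs_le.2 ⟨le_max_left _ _, max_le (by norm_num) (min_le_right _ _)⟩, ?_⟩
  have hpull := condExp_stronglyMeasurable_mul_of_bound hX.comap_le
    (stronglyMeasurable_condExp (f := f) (m := m) (μ := μ)) hfi 1 hbd
  calc ∫ t, (μ[f | m]) t ^ 2 ∂μ = ∫ t, (μ[μ[f | m] * f | m]) t ∂μ := by
        refine integral_congr_ae ?_
        filter_upwards [hpull] with t ht
        rw [ht, Pi.mul_apply, sq]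
    _ = ∫ t, (μ[f | m] * f) t ∂μ := integral_condExp hX.comap_le
    _ = _ := by
        refine integral_congr_ae ?_
        filter_upwards [hbd] with t ht
        have hφt : (μ[f | m]) t = φ (X t) := congrFun hφX t
        rw [hφt, abs_le] at ht
        rw [Pi.mul_apply, hφt, min_eq_left ht.2, max_eq_right ht.1]

/-- Let `λ` be Lebesgue measure on `[0,1]` (the volume measure on the
subtype `[0,1] ⊆ ℝ`) and `X : [0,1] → [0,1]` Borel measurable.  If there are a mod-null
isomorphism `Ψ : ([0,1], λ) → ([0,1]², λ × λ)` and a Borel `Z : [0,1] → [0,1]` with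
`Z ∘ π₁ ∘ Ψ = X` λ-a.e., then there are Borel `Z_n : [0,1] → {−1,1}` such that for every
Borel `W : [0,1] → [0,1]`, `‖E[Z_n · W | σ(X)]‖_{L²(λ)} → 0`. -/
theorem modNullIso_factorization_implies_conditional_mixing
    (X : ↥I01 → ↥I01) (hX : Measurable X)
    (h4 : ∃ (Ψ : ↥I01 → ↥I01 × ↥I01) (Ψ' : ↥I01 × ↥I01 → ↥I01) (Z : ↥I01 → ↥I01),
      Measurable Z ∧
      MeasurePreserving Ψ volume ((volume : Measure ↥I01).prod volume) ∧
      MeasurePreserving Ψ' ((volume : Measure ↥I01).prod volume) volume ∧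
      (∀ᵐ t ∂(volume : Measure ↥I01), Ψ' (Ψ t) = t) ∧
      (∀ᵐ p ∂((volume : Measure ↥I01).prod volume), Ψ (Ψ' p) = p) ∧
      (∀ᵐ t ∂(volume : Measure ↥I01), Z (Ψ t).1 = X t)) :
    ∃ Z : ℕ → ↥I01 → ℝ,
      (∀ n, Measurable (Z n)) ∧
      (∀ n t, Z n t = 1 ∨ Z n t = -1) ∧
      ∀ W : ↥I01 → ↥I01, Measurable W →
        Tendsto (fun n =>
            eLpNorm
              ((volume : Measure ↥I01)[(fun t => Z n t * (W t : ℝ)) |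
                MeasurableSpace.comap X inferInstance]) 2 volume)
          atTop (𝓝 0) := by
  obtain ⟨Ψ, Ψ', Z, hZ, hΨ, hΨ', hinv, -, hZX⟩ := h4
  have hr : ∀ n : ℕ, Measurable fun t => rademacher (n + 1) (Ψ t).2 := fun n =>
    (measurable_rademacher _).comp (measurable_subtype_coe.comp hΨ.measurable.snd)
  refine ⟨fun n t => rademacher (n + 1) (Ψ t).2, hr, fun n t => rademacher_eq_one_or _ _,
    fun W hW => ?_⟩
  have hW1 : ∀ t, |(W t : ℝ)| ≤ 1 := fun t => abs_le.2 ⟨by linarith [(W t).2.1], (W t).2.2⟩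
  set f : ℕ → ↥I01 → ℝ := fun n t => rademacher (n + 1) (Ψ t).2 * (W t : ℝ)
  set w : ↥I01 × ↥I01 → ℝ := fun p => (W (Ψ' p) : ℝ)
  have hw : Measurable w := measurable_subtype_coe.comp (hW.comp hΨ'.measurable)
  have hf : ∀ n, Measurable (f n) := fun n => (hr n).mul (measurable_subtype_coe.comp hW)
  have hf1 : ∀ n t, |f n t| ≤ 1 := fun n t => by simpa [f, abs_mul, abs_rademacher] using hW1 t
  have hlim : Tendsto (fun n => ∫ t, ((volume : Measure ↥I01)[f n |
      MeasurableSpace.comap X inferInstance]) t ^ 2) atTop (𝓝 0) := by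
    refine squeeze_zero (fun n => integral_nonneg fun t => sq_nonneg _) (fun n => ?_)
      (tendsto_integral_abs_integral_rademacher_mul (μ := (volume : Measure ↥I01)) hw
        fun p => hW1 (Ψ' p))
    obtain ⟨φ, hφ, hφ1, hφf⟩ :=
      exists_integral_sq_condExp_comap (μ := (volume : Measure ↥I01)) hX (hf n) (hf1 n)
    have hh : Measurable fun p : ↥I01 × ↥I01 => rademacher (n + 1) p.2 * w p :=
      ((measurable_rademacher _).comp (measurable_subtype_coe.comp measurable_snd)).mul hw
    have hb : Measurable fun x => φ (Z x) := hφ.comp hZ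
    have hcov : ∫ t, φ (X t) * f n t =
        ∫ p : ↥I01 × ↥I01, φ (Z p.1) * (rademacher (n + 1) p.2 * w p)
          ∂((volume : Measure ↥I01).prod volume) := by
      have hbh : Measurable fun p : ↥I01 × ↥I01 => φ (Z p.1) * (rademacher (n + 1) p.2 * w p) :=
        (hb.comp measurable_fst).mul hh
      rw [← hΨ.map_eq, integral_map hΨ.aemeasurable hbh.aestronglyMeasurable]
      refine integral_congr_ae ?_
      filter_upwards [hinv, hZX] with t h1 h2
      simp only [f, w, h1, h2]
    rw [hφf, hcov]
    exact integral_prod_mul_le hb (fun x => hφ1 (Z x)) hh fun p => by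
      simpa [abs_mul, abs_rademacher] using hW1 (Ψ' p)
  have hnorm : ∀ n, eLpNorm ((volume : Measure ↥I01)[f n |
      MeasurableSpace.comap X inferInstance]) 2 volume =
      ENNReal.ofReal √(∫ t, ((volume : Measure ↥I01)[f n |
        MeasurableSpace.comap X inferInstance]) t ^ 2) := by
    intro n
    have hLp : MemLp (f n) 2 (volume : Measure ↥I01) :=
      MemLp.of_bound (hf n).aestronglyMeasurable 1 (ae_of_all _ (hf1 n))
    rw [(hLp.condExp one_le_two).eLpNorm_eq_integral_rpow_norm two_ne_zero ENNReal.ofNat_ne_top,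
      Real.sqrt_eq_rpow]
    simp
  refine Tendsto.congr (fun n => (hnorm n).symm) ?_
  simpa using ENNReal.tendsto_ofReal hlim.sqrt
end
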